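/- For every ε > 0 there exists a constant c = c(ε) > 0 such that for every cubic integer polynomial P with nonzero discriminant D(P) and every real H ≥ 1, the number of integer polynomials Q of degree at most 3 that are equivalent to P and have naive height at most H is at most c·H^{2/3+ε}·|D(P)|^{−1/6}. -/

import Mathlib

open Polynomial

/-- Discriminant of the cubic polynomial `c₃x³ + c₂x² + c₁x + c₀`. -/
def cubicDisc (c₀ c₁ c₂ c₃ : ℤ) : ℤ :=
  c₁ ^ 2 * c₂ ^ 2 - 4 * c₀ * c₂ ^ 3 - 4 * c₁ ^ 3 * c₃ - 27 * c₀ ^ 2 * c₃ ^ 2 +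
    18 * c₀ * c₁ * c₂ * c₃

/-- Two integer polynomials of degree at most 3, given by coefficient vectors
`p, q ∈ ℤ⁴`, are equivalent if there are integers `a, b, c, d` with `ad − bc = ±1`
such that `Q(x) = Σ_{i=0}^{3} p_i (ax+b)^i (cx+d)^{3−i}`. -/
def cubicEquiv (p q : Fin 4 → ℤ) : Prop :=
  ∃ a b c d : ℤ, (a * d - b * c = 1 ∨ a * d - b * c = -1) ∧
    (∑ i : Fin 4, C (q i) * X ^ (i : ℕ)) =
      ∑ i : Fin 4, C (p i) * (C a * X + C b) ^ (i : ℕ) * (C c * X + C d) ^ (3 - (i : ℕ))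

namespace CubicCount

/-- determinant of two integer vectors -/
def dt (u v : ℤ × ℤ) : ℤ := u.1 * v.2 - u.2 * v.1

/-- the integral seminorm properties which are needed -/
structure SN (N : ℤ × ℤ → ℝ) : Prop where
  nonneg : ∀ u, 0 ≤ N u
  sub : ∀ u v, N (u - v) ≤ N u + N v
  smul : ∀ (k : ℤ) u, N (k • u) = |(k : ℝ)| * N u

lemma SN.neg {N : ℤ × ℤ → ℝ} (h : SN N) (u : ℤ × ℤ) : N (-u) = N u := by
  have := h.smul (-1) u
  simpa using this

lemma dt_comm (u v : ℤ × ℤ) : dt u v = - dt v u := by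
  unfold dt; ring

lemma card_Icc_le {x : ℝ} (hx : 0 ≤ x) :
    ((Finset.Icc (-⌊x⌋) ⌊x⌋).card : ℝ) ≤ 2 * x + 1 := by
  have h0 : 0 ≤ ⌊x⌋ := Int.floor_nonneg.2 hx
  have : ((Finset.Icc (-⌊x⌋) ⌊x⌋).card : ℤ) = 2 * ⌊x⌋ + 1 := by
    rw [Int.card_Icc]; omega
  have h2 : ((Finset.Icc (-⌊x⌋) ⌊x⌋).card : ℝ) = 2 * (⌊x⌋ : ℝ) + 1 := by exact_mod_cast this
  rw [h2]
  linarith [Int.floor_le x]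

/-- vectors on a line parallel to `u0` -/
lemma card_line {N : ℤ × ℤ → ℝ} (hN : SN N) (u0 w : ℤ × ℤ) (hw : |dt u0 w| = 1)
    (hm : 0 < N u0) (s : ℝ) (hs : N u0 ≤ s) (j : ℤ) (t : Finset (ℤ × ℤ))
    (ht : ∀ v ∈ t, dt u0 v = j ∧ N v ≤ s) : (t.card : ℝ) ≤ 5 * s / N u0 := by
  have hspos : 0 < s := lt_of_lt_of_le hm hs
  rcases t.eq_empty_or_nonempty with rfl | ⟨v0, hv0⟩
  · simp; positivity
  have key : ∀ v ∈ t, v - v0 = (dt u0 w * dt (v - v0) w) • u0 := by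
    intro v hv
    have h1 := (ht v hv).1
    have h2 := (ht v0 hv0).1
    have hsq : dt u0 w * dt u0 w = 1 := by
      rcases (abs_eq (by norm_num : (0:ℤ) ≤ 1)).1 hw with h | h <;> rw [h] <;> norm_num
    unfold dt at *
    ext
    · simp only [Prod.fst_sub, Prod.snd_sub, Prod.smul_fst, smul_eq_mul]
      linear_combination (-(v.1 - v0.1)) * hsq + (u0.1 * w.2 - u0.2 * w.1) * w.1 * (h1 - h2)
    · simp only [Prod.fst_sub, Prod.snd_sub, Prod.smul_snd, smul_eq_mul]
      linear_combination (-(v.2 - v0.2)) * hsq + (u0.1 * w.2 - u0.2 * w.1) * w.2 * (h1 - h2)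
  have hx : 0 ≤ 2 * s / N u0 := by positivity
  have hcard : t.card ≤ (Finset.Icc (-⌊2 * s / N u0⌋) ⌊2 * s / N u0⌋).card := by
    apply Finset.card_le_card_of_injOn (fun v => dt u0 w * dt (v - v0) w)
    · intro v hv
      have hv' : v ∈ t := hv
      have h3 : N (v - v0) ≤ 2 * s := by
        linarith [hN.sub v v0, (ht v hv').2, (ht v0 hv0).2]
      rw [key v hv', hN.smul] at h3
      have h4 : |((dt u0 w * dt (v - v0) w : ℤ) : ℝ)| ≤ 2 * s / N u0 := by
        rw [le_div_iff₀ hm]; exact h3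
      have h5 := abs_le.1 h4
      simp only [Finset.coe_Icc, Set.mem_Icc]
      constructor
      · rw [neg_le, Int.le_floor]; push_cast at h5 ⊢; linarith [h5.1]
      · rw [Int.le_floor]; push_cast at h5 ⊢; exact h5.2
    · intro v hv v' hv' hvv
      have h1 := key v hv
      have h2 := key v' hv'
      simp only at hvv
      rw [hvv, ← h2] at h1
      exact sub_left_injective h1
  have h1 : (1:ℝ) ≤ s / N u0 := by rw [le_div_iff₀ hm]; linarith
  calc (t.card : ℝ) ≤ _ := by exact_mod_cast hcard
    _ ≤ 2 * (2 * s / N u0) + 1 := card_Icc_le hx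
    _ ≤ 5 * s / N u0 := by
      have : 5 * s / N u0 = 2 * (2 * s / N u0) + s / N u0 := by ring
      linarith

/-- primitive vectors apart from `±e` -/
lemma card_ball {N : ℤ × ℤ → ℝ} (hN : SN N) {K : ℝ}
    (hK : ∀ u v, |(dt u v : ℝ)| ≤ K * N u * N v)
    (e w : ℤ × ℤ) (hw : |dt e w| = 1) (hm : 0 < N e) (hK0 : 0 ≤ K) (s : ℝ)
    (t : Finset (ℤ × ℤ)) (ht : ∀ u ∈ t, dt e u ≠ 0 ∧ N e ≤ N u ∧ N u ≤ s) :
    (t.card : ℝ) ≤ 10 * K * s ^ 2 := by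
  rcases t.eq_empty_or_nonempty with rfl | ⟨v0, hv0⟩
  · simp; positivity
  have hs : N e ≤ s := (ht v0 hv0).2.1.trans (ht v0 hv0).2.2
  have hspos : 0 < s := lt_of_lt_of_le hm hs
  set x : ℝ := K * N e * s with hx
  have hx0 : 0 ≤ x := by positivity
  set J : Finset ℤ := (Finset.Icc (-⌊x⌋) ⌊x⌋).erase 0 with hJ
  have hJc : (J.card : ℝ) ≤ 2 * x := by
    have h0 : (0:ℤ) ∈ Finset.Icc (-⌊x⌋) ⌊x⌋ := by
      have := Int.floor_nonneg.2 hx0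
      simp [this]
    have := Finset.card_erase_add_one h0
    have h2 := card_Icc_le hx0
    rw [← this] at h2
    push_cast at h2
    linarith
  have hmaps : ∀ u ∈ t, dt e u ∈ J := by
    intro u hu
    obtain ⟨h1, h2, h3⟩ := ht u hu
    have h4 : |(dt e u : ℝ)| ≤ x := (hK e u).trans (by rw [hx]; gcongr)
    have h5 := abs_le.1 h4
    simp only [hJ, Finset.mem_erase, Finset.mem_Icc]
    refine ⟨h1, ?_, ?_⟩
    · rw [neg_le, Int.le_floor]; push_cast; linarith [h5.1]
    · rw [Int.le_floor]; exact h5.2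
  rw [Finset.card_eq_sum_card_fiberwise hmaps]
  push_cast
  calc ∑ j ∈ J, ((t.filter fun u => dt e u = j).card : ℝ) ≤ ∑ j ∈ J, 5 * s / N e := by
        apply Finset.sum_le_sum
        intro j _
        apply card_line hN e w hw hm s hs j
        intro v hv
        rw [Finset.mem_filter] at hv
        exact ⟨hv.2, (ht v hv.1).2.2⟩
    _ = J.card * (5 * s / N e) := by simp
    _ ≤ 2 * x * (5 * s / N e) := by gcongr
    _ = 10 * K * s ^ 2 := by rw [hx]; field_simp; ring

lemma sum_half_le (s : Finset ℕ) : ∑ k ∈ s, (1 / 2 : ℝ) ^ k ≤ 2 := by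
  have := summable_geometric_two.sum_le_tsum s (fun i _ => by positivity)
  rwa [tsum_geometric_two] at this

lemma sum_inv {N : ℤ × ℤ → ℝ} (hN : SN N) {K : ℝ}
    (hK : ∀ u v, |(dt u v : ℝ)| ≤ K * N u * N v)
    (e w : ℤ × ℤ) (hw : |dt e w| = 1) (hm : 0 < N e) (hK0 : 0 ≤ K)
    (t : Finset (ℤ × ℤ)) (ht : ∀ u ∈ t, dt e u ≠ 0 ∧ N e ≤ N u ∧ N u ≤ 1) :
    ∑ u ∈ t, 1 / N u ≤ 40 * K := by
  have hex : ∀ u : ℤ × ℤ, ∃ k : ℕ, u ∈ t → (1 / 2 : ℝ) ^ (k + 1) < N u ∧ N u ≤ (1 / 2 : ℝ) ^ k := by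
    intro u
    by_cases hu : u ∈ t
    · obtain ⟨k, hk⟩ := exists_nat_pow_near_of_lt_one (lt_of_lt_of_le hm (ht u hu).2.1)
        (ht u hu).2.2 (by norm_num : (0:ℝ) < 1/2) (by norm_num)
      exact ⟨k, fun _ => hk⟩
    · exact ⟨0, fun h => absurd h hu⟩
  choose κ hκ using hex
  rw [← Finset.sum_fiberwise_of_maps_to (fun u hu => Finset.mem_image_of_mem κ hu)]
  calc ∑ k ∈ t.image κ, ∑ u ∈ t with κ u = k, 1 / N u
      ≤ ∑ k ∈ t.image κ, 20 * K * (1 / 2 : ℝ) ^ k := by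
        apply Finset.sum_le_sum
        intro k _
        have h1 : ∀ u ∈ t.filter (fun u => κ u = k), 1 / N u ≤ 2 ^ (k + 1) := by
          intro u hu
          rw [Finset.mem_filter] at hu
          have h2 := (hκ u hu.1).1
          rw [hu.2] at h2
          have h3 : (2:ℝ) ^ (k + 1) = 1 / (1 / 2 : ℝ) ^ (k + 1) := by
            rw [one_div_pow, one_div_one_div]
          rw [h3]
          exact one_div_le_one_div_of_le (by positivity) h2.le
        have h4 := Finset.sum_le_card_nsmul _ _ _ h1
        rw [nsmul_eq_mul] at h4
        have h5 : ((t.filter (fun u => κ u = k)).card : ℝ) ≤ 10 * K * ((1 / 2 : ℝ) ^ k) ^ 2 := by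
          apply card_ball hN hK e w hw hm hK0
          intro u hu
          rw [Finset.mem_filter] at hu
          refine ⟨(ht u hu.1).1, (ht u hu.1).2.1, ?_⟩
          have := (hκ u hu.1).2
          rwa [hu.2] at this
        refine h4.trans ((mul_le_mul_of_nonneg_right h5 (by positivity)).trans (le_of_eq ?_))
        have h6 : (1 / 2 : ℝ) ^ k * 2 ^ k = 1 := by rw [← mul_pow]; norm_num
        rw [pow_succ]
        linear_combination (20 * K * (1 / 2 : ℝ) ^ k) * h6
    _ = 20 * K * ∑ k ∈ t.image κ, (1 / 2 : ℝ) ^ k := by rw [Finset.mul_sum]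
    _ ≤ 20 * K * 2 := by gcongr; exact sum_half_le _
    _ = 40 * K := by ring

/-- bases with first vector the shorter one -/
lemma card_half {N : ℤ × ℤ → ℝ} (hN : SN N) {K : ℝ}
    (hK : ∀ u v, |(dt u v : ℝ)| ≤ K * N u * N v) (hK0 : 0 ≤ K)
    (s : Finset ((ℤ × ℤ) × (ℤ × ℤ)))
    (hs : ∀ q ∈ s, |dt q.1 q.2| = 1 ∧ N q.1 ≤ N q.2 ∧ N q.2 ≤ 1) :
    (s.card : ℝ) ≤ 420 * K := by
  classical
  rcases s.eq_empty_or_nonempty with rfl | hne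
  · simp; positivity
  have hpos : ∀ q ∈ s, 0 < N q.1 := by
    intro q hq
    rcases (hN.nonneg q.1).lt_or_eq with h | h
    · exact h
    · have h1 := hK q.1 q.2
      have h2 : |(dt q.1 q.2 : ℝ)| = 1 := by exact_mod_cast (hs q hq).1
      rw [← h, h2] at h1
      norm_num at h1
  obtain ⟨q0, hq0, hmin⟩ := Finset.exists_min_image s (fun q => N q.1) hne
  set e := q0.1 with he
  set w := q0.2 with hw
  have hm : 0 < N e := hpos q0 hq0
  have hdt : |dt e w| = 1 := (hs q0 hq0).1
  set U := s.image Prod.fst with hU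
  have hUp : ∀ u ∈ U, ∃ v, |dt u v| = 1 ∧ N u ≤ 1 ∧ N e ≤ N u ∧ 0 < N u := by
    intro u hu
    rw [hU, Finset.mem_image] at hu
    obtain ⟨q, hq, rfl⟩ := hu
    exact ⟨q.2, (hs q hq).1, (hs q hq).2.1.trans (hs q hq).2.2, hmin q hq, hpos q hq⟩
  have hKm : 1 ≤ K * N e := by
    have h1 := hK e w
    have h2 : |(dt e w : ℝ)| = 1 := by exact_mod_cast hdt
    rw [h2] at h1
    have h3 : K * N e * N w ≤ K * N e * 1 := by
      gcongr; exact (hs q0 hq0).2.2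
    linarith
  have hsum : ∑ u ∈ U, 1 / N u ≤ 42 * K := by
    rw [← Finset.sum_filter_add_sum_filter_not U (fun u => dt e u ≠ 0)]
    have h1 : ∑ u ∈ U with dt e u ≠ 0, 1 / N u ≤ 40 * K := by
      apply sum_inv hN hK e w hdt hm hK0
      intro u hu
      rw [Finset.mem_filter] at hu
      obtain ⟨v, h1, h2, h3, h4⟩ := hUp u hu.1
      exact ⟨hu.2, h3, h2⟩
    have h2 : ∑ u ∈ U with ¬ dt e u ≠ 0, 1 / N u ≤ 2 * K := by
      have hsub : U.filter (fun u => ¬ dt e u ≠ 0) ⊆ {e, -e} := by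
        intro u hu
        rw [Finset.mem_filter, not_not] at hu
        obtain ⟨v, h1, -⟩ := hUp u hu.1
        have h0 := hu.2
        -- u = k e with k = ± dt u w
        have hk : u = (dt e w * dt u w) • e := by
          have hsq : dt e w * dt e w = 1 := by
            rcases (abs_eq (by norm_num : (0:ℤ) ≤ 1)).1 hdt with h | h <;> rw [h] <;> norm_num
          unfold dt at h0 hsq ⊢
          ext
          · simp only [Prod.smul_fst, smul_eq_mul]
            linear_combination (-u.1) * hsq + (e.1 * w.2 - e.2 * w.1) * w.1 * h0
          · simp only [Prod.smul_snd, smul_eq_mul]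
            linear_combination (-u.2) * hsq + (e.1 * w.2 - e.2 * w.1) * w.2 * h0
        generalize dt e w * dt u w = k at hk
        have h5 : dt u v = k * dt e v := by
          rw [hk]; unfold dt; simp only [Prod.smul_fst, Prod.smul_snd, smul_eq_mul]; ring
        have h6 : IsUnit k := by
          rw [h5] at h1
          exact isUnit_of_dvd_unit (Dvd.intro _ rfl) (Int.isUnit_iff_abs_eq.2 h1)
        rcases Int.isUnit_iff.1 h6 with h | h
        · rw [hk, h]; simp
        · rw [hk, h]; simp
      have hle : ∀ u ∈ ({e, -e} : Finset (ℤ × ℤ)), 1 / N u ≤ K := by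
        intro u hu
        have : N u = N e := by
          rw [Finset.mem_insert, Finset.mem_singleton] at hu
          rcases hu with rfl | rfl
          · rfl
          · exact hN.neg _
        rw [this, div_le_iff₀ hm]; exact hKm
      have h3 := Finset.sum_le_card_nsmul _ _ _ (fun u hu => hle u (hsub hu))
      have h4 : (U.filter (fun u => ¬ dt e u ≠ 0)).card ≤ 2 :=
        (Finset.card_le_card hsub).trans Finset.card_le_two
      rw [nsmul_eq_mul] at h3
      refine h3.trans ?_
      gcongr
      exact_mod_cast h4
    linarith
  have hmaps : ∀ q ∈ s, q.1 ∈ U := fun q hq => Finset.mem_image_of_mem _ hq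
  rw [Finset.card_eq_sum_card_fiberwise hmaps]
  push_cast
  calc ∑ u ∈ U, ((s.filter fun q => q.1 = u).card : ℝ) ≤ ∑ u ∈ U, 10 * (1 / N u) := by
        apply Finset.sum_le_sum
        intro u hu
        obtain ⟨v, h1, h2, h3, h4⟩ := hUp u hu
        have hline : ∀ j : ℤ, ((((s.filter fun q => q.1 = u).image Prod.snd).filter
            fun v => dt u v = j).card : ℝ) ≤ 5 * 1 / N u := by
          intro j
          apply card_line hN u v h1 h4 1 h2 j
          intro v' hv'
          rw [Finset.mem_filter, Finset.mem_image] at hv'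
          obtain ⟨⟨q, hq, rfl⟩, hj⟩ := hv'
          exact ⟨hj, (hs q (Finset.mem_filter.1 hq).1).2.2⟩
        have hc : (s.filter fun q => q.1 = u).card =
            ((s.filter fun q => q.1 = u).image Prod.snd).card := by
          rw [Finset.card_image_of_injOn]
          intro q hq q' hq' hqq
          have a1 := (Finset.mem_filter.1 hq).2
          have a2 := (Finset.mem_filter.1 hq').2
          exact Prod.ext (a1.trans a2.symm) hqq
        have hsubs : ((s.filter fun q => q.1 = u).image Prod.snd) ⊆
            (((s.filter fun q => q.1 = u).image Prod.snd).filter fun v => dt u v = 1) ∪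
            (((s.filter fun q => q.1 = u).image Prod.snd).filter fun v => dt u v = -1) := by
          intro v' hv'
          have hv2 := hv'
          rw [Finset.mem_image] at hv2
          obtain ⟨q, hq, rfl⟩ := hv2
          obtain ⟨hq1, hq2⟩ := Finset.mem_filter.1 hq
          have := (hs q hq1).1
          rw [hq2] at this
          rw [Finset.mem_union, Finset.mem_filter, Finset.mem_filter]
          rcases (abs_eq (by norm_num : (0:ℤ) ≤ 1)).1 this with h | h
          · exact Or.inl ⟨hv', h⟩
          · exact Or.inr ⟨hv', h⟩
        have hcc := (Finset.card_le_card hsubs).trans (Finset.card_union_le _ _)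
        rw [← hc] at hcc
        have hcr := (Nat.cast_le (α := ℝ)).2 hcc
        push_cast at hcr
        have e1 := hline 1
        have e2 := hline (-1)
        have e3 : 5 * 1 / N u + 5 * 1 / N u = 10 * (1 / N u) := by ring
        linarith
    _ = 10 * ∑ u ∈ U, 1 / N u := by rw [Finset.mul_sum]
    _ ≤ 420 * K := by linarith

lemma card_bases {N : ℤ × ℤ → ℝ} (hN : SN N) {K : ℝ}
    (hK : ∀ u v, |(dt u v : ℝ)| ≤ K * N u * N v) (hK0 : 0 ≤ K)
    (s : Finset ((ℤ × ℤ) × (ℤ × ℤ)))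
    (hs : ∀ q ∈ s, |dt q.1 q.2| = 1 ∧ N q.1 ≤ 1 ∧ N q.2 ≤ 1) :
    (s.card : ℝ) ≤ 840 * K := by
  classical
  have h := Finset.card_filter_add_card_filter_not (s := s) (fun q => N q.1 ≤ N q.2)
  have h1 : ((s.filter fun q => N q.1 ≤ N q.2).card : ℝ) ≤ 420 * K := by
    apply card_half hN hK hK0
    intro q hq
    rw [Finset.mem_filter] at hq
    exact ⟨(hs q hq.1).1, hq.2, (hs q hq.1).2.2⟩
  have h2 : ((s.filter fun q => ¬ N q.1 ≤ N q.2).card : ℝ) ≤ 420 * K := by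
    rw [← Finset.card_image_of_injective _ Prod.swap_injective]
    apply card_half hN hK hK0
    intro q hq
    rw [Finset.mem_image] at hq
    obtain ⟨q', hq', rfl⟩ := hq
    rw [Finset.mem_filter] at hq'
    have := hs q' hq'.1
    refine ⟨?_, ?_, ?_⟩
    · simp only [Prod.fst_swap, Prod.snd_swap]
      rw [dt_comm, abs_neg]; exact this.1
    · exact (not_le.1 hq'.2).le
    · exact this.2.1
  have h3 : (s.card : ℝ) = ((s.filter fun q => N q.1 ≤ N q.2).card : ℝ) +
    ((s.filter fun q => ¬ N q.1 ≤ N q.2).card : ℝ) := by exact_mod_cast h.symm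
  linarith

/-- box count -/
lemma card_box {N₁ N₂ : ℤ × ℤ → ℝ} (h₁ : SN N₁) (h₂ : SN N₂) {δ : ℝ} (hδ : 0 < δ)
    (hd : ∀ u v, δ * |(dt u v : ℝ)| ≤ N₁ u * N₂ v + N₁ v * N₂ u)
    {A B : ℝ} (hA : 0 < A) (hB : 0 < B)
    (s : Finset ((ℤ × ℤ) × (ℤ × ℤ)))
    (hs : ∀ q ∈ s, |dt q.1 q.2| = 1 ∧ (N₁ q.1 ≤ A ∧ N₁ q.2 ≤ A) ∧ (N₂ q.1 ≤ B ∧ N₂ q.2 ≤ B)) :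
    (s.card : ℝ) ≤ 1680 * (A * B / δ) := by
  set N : ℤ × ℤ → ℝ := fun u => max (N₁ u / A) (N₂ u / B) with hNdef
  have hN : SN N := by
    refine ⟨fun u => ?_, fun u v => ?_, fun k u => ?_⟩
    · exact le_max_of_le_left (div_nonneg (h₁.nonneg u) hA.le)
    · apply max_le
      · calc N₁ (u - v) / A ≤ (N₁ u + N₁ v) / A := by gcongr; exact h₁.sub u v
          _ = N₁ u / A + N₁ v / A := by ring
          _ ≤ _ := add_le_add (le_max_left _ _) (le_max_left _ _)
      · calc N₂ (u - v) / B ≤ (N₂ u + N₂ v) / B := by gcongr; exact h₂.sub u v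
          _ = N₂ u / B + N₂ v / B := by ring
          _ ≤ _ := add_le_add (le_max_right _ _) (le_max_right _ _)
    · simp only [hNdef, h₁.smul, h₂.smul, mul_div_assoc]
      rw [mul_max_of_nonneg _ _ (abs_nonneg _)]
  have hK : ∀ u v, |(dt u v : ℝ)| ≤ (2 * (A * B / δ)) * N u * N v := by
    intro u v
    have a1 : ∀ u, N₁ u ≤ A * N u := by
      intro u
      have : N₁ u / A ≤ N u := le_max_left _ _
      rw [div_le_iff₀ hA] at this; linarith
    have a2 : ∀ u, N₂ u ≤ B * N u := by
      intro u
      have : N₂ u / B ≤ N u := le_max_right _ _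
      rw [div_le_iff₀ hB] at this; linarith
    have a3 : N₁ u * N₂ v ≤ (A * N u) * (B * N v) :=
      mul_le_mul (a1 u) (a2 v) (h₂.nonneg v) (mul_nonneg hA.le (hN.nonneg u))
    have a4 : N₁ v * N₂ u ≤ (A * N v) * (B * N u) :=
      mul_le_mul (a1 v) (a2 u) (h₂.nonneg u) (mul_nonneg hA.le (hN.nonneg v))
    have a5 := hd u v
    have a6 : (2 * (A * B / δ)) * N u * N v = (2 * A * B * N u * N v) / δ := by ring
    rw [a6, le_div_iff₀ hδ]
    linarith
  have := card_bases hN hK (by positivity) s (by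
    intro q hq
    obtain ⟨b1, ⟨b2, b3⟩, b4, b5⟩ := hs q hq
    refine ⟨b1, max_le ?_ ?_, max_le ?_ ?_⟩
    · exact (div_le_one hA).2 b2
    · exact (div_le_one hB).2 b4
    · exact (div_le_one hA).2 b3
    · exact (div_le_one hB).2 b5)
  linarith

lemma card_two {N₁ N₂ : ℤ × ℤ → ℝ} (h₁ : SN N₁) (h₂ : SN N₂) {δ : ℝ} (hδ : 0 < δ)
    (hd : ∀ u v, δ * |(dt u v : ℝ)| ≤ N₁ u * N₂ v + N₁ v * N₂ u)
    {T : ℝ} (hT : 0 < T)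
    (s : Finset ((ℤ × ℤ) × (ℤ × ℤ)))
    (hs : ∀ q ∈ s, |dt q.1 q.2| = 1 ∧ max (N₁ q.1) (N₁ q.2) ≤ max (N₂ q.1) (N₂ q.2) ∧
      max (N₁ q.1) (N₁ q.2) * max (N₂ q.1) (N₂ q.2) ^ 2 ≤ T ^ 3) :
    (s.card : ℝ) ≤ 8400 * (T ^ 2 / δ) := by
  classical
  set n₁ : (ℤ × ℤ) × (ℤ × ℤ) → ℝ := fun q => max (N₁ q.1) (N₁ q.2) with hn₁
  set n₂ : (ℤ × ℤ) × (ℤ × ℤ) → ℝ := fun q => max (N₂ q.1) (N₂ q.2) with hn₂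
  have hbox : ∀ {A B : ℝ}, 0 < A → 0 < B → ∀ t : Finset ((ℤ × ℤ) × (ℤ × ℤ)),
      (∀ q ∈ t, q ∈ s ∧ n₁ q ≤ A ∧ n₂ q ≤ B) → (t.card : ℝ) ≤ 1680 * (A * B / δ) := by
    intro A B hA hB t ht
    apply card_box h₁ h₂ hδ hd hA hB
    intro q hq
    obtain ⟨c1, c2, c3⟩ := ht q hq
    exact ⟨(hs q c1).1, max_le_iff.1 c2, max_le_iff.1 c3⟩
  have h := Finset.card_filter_add_card_filter_not (s := s) (fun q => n₂ q ≤ T)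
  have e1 : ((s.filter fun q => n₂ q ≤ T).card : ℝ) ≤ 1680 * (T ^ 2 / δ) := by
    rw [pow_two]
    apply hbox hT hT
    intro q hq
    rw [Finset.mem_filter] at hq
    exact ⟨hq.1, (hs q hq.1).2.1.trans hq.2, hq.2⟩
  set t := s.filter fun q => ¬ n₂ q ≤ T with ht
  have hts : ∀ q ∈ t, q ∈ s ∧ T < n₂ q := by
    intro q hq
    rw [ht, Finset.mem_filter] at hq
    exact ⟨hq.1, not_le.1 hq.2⟩
  have hex : ∀ q, ∃ k : ℕ, q ∈ t → (2 : ℝ) ^ k * T ≤ n₂ q ∧ n₂ q ≤ 2 ^ (k + 1) * T := by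
    intro q
    by_cases hq : q ∈ t
    · obtain ⟨k, hk1, hk2⟩ := exists_nat_pow_near (x := n₂ q / T) (y := (2:ℝ))
        (by rw [le_div_iff₀ hT]; linarith [(hts q hq).2]) (by norm_num)
      refine ⟨k, fun _ => ⟨(le_div_iff₀ hT).1 hk1, ((div_lt_iff₀ hT).1 hk2).le⟩⟩
    · exact ⟨0, fun h => absurd h hq⟩
  choose κ hκ using hex
  have e2 : (t.card : ℝ) ≤ 6720 * (T ^ 2 / δ) := by
    rw [Finset.card_eq_sum_card_fiberwise (fun q hq => Finset.mem_image_of_mem κ hq)]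
    push_cast
    calc ∑ k ∈ t.image κ, ((t.filter fun q => κ q = k).card : ℝ)
        ≤ ∑ k ∈ t.image κ, 3360 * (T ^ 2 / δ) * (1 / 2 : ℝ) ^ k := by
          apply Finset.sum_le_sum
          intro k _
          have h6 : (1 / 2 : ℝ) ^ k * 2 ^ k = 1 := by rw [← mul_pow]; norm_num
          have hb := hbox (A := T * ((1 / 2 : ℝ) ^ k) ^ 2) (B := 2 ^ (k + 1) * T) (by positivity)
            (by positivity) (t.filter fun q => κ q = k) (by
              intro q hq
              rw [Finset.mem_filter] at hq
              obtain ⟨hq, rfl⟩ := hq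
              obtain ⟨d1, d2⟩ := hκ q hq
              refine ⟨(hts q hq).1, ?_, d2⟩
              have d3 := (hs q (hts q hq).1).2.2
              have d4 : n₁ q * (2 ^ (κ q) * T) ^ 2 ≤ T ^ 3 := by
                refine le_trans ?_ d3
                have : 0 ≤ n₁ q := le_max_of_le_left (h₁.nonneg _)
                gcongr
              have d5 : n₁ q * (2 ^ (κ q) * T) ^ 2 ≤
                  (T * ((1 / 2 : ℝ) ^ (κ q)) ^ 2) * (2 ^ (κ q) * T) ^ 2 := by
                refine d4.trans (le_of_eq ?_)
                calc T ^ 3 = T ^ 3 * ((1 / 2 : ℝ) ^ (κ q) * 2 ^ (κ q)) ^ 2 := by rw [h6]; ring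
                  _ = _ := by ring
              exact le_of_mul_le_mul_right d5 (by positivity))
          refine hb.trans (le_of_eq ?_)
          rw [pow_succ]
          linear_combination (3360 * (T ^ 2 / δ) * (1 / 2 : ℝ) ^ k) * h6
      _ = 3360 * (T ^ 2 / δ) * ∑ k ∈ t.image κ, (1 / 2 : ℝ) ^ k := by rw [Finset.mul_sum]
      _ ≤ 3360 * (T ^ 2 / δ) * 2 := by gcongr; exact sum_half_le _
      _ = _ := by ring
  have h3 : (s.card : ℝ) = ((s.filter fun q => n₂ q ≤ T).card : ℝ) + (t.card : ℝ) := by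
    exact_mod_cast h.symm
  linarith

lemma card_three {N₁ N₂ N₃ : ℤ × ℤ → ℝ} (h₁ : SN N₁) (h₂ : SN N₂) (h₃ : SN N₃)
    {δ : ℝ} (hδ : 0 < δ)
    (hd₁ : ∀ u v, δ * |(dt u v : ℝ)| ≤ N₁ u * N₂ v + N₁ v * N₂ u)
    (hd₂ : ∀ u v, δ * |(dt u v : ℝ)| ≤ N₂ u * N₃ v + N₂ v * N₃ u)
    (hd₃ : ∀ u v, δ * |(dt u v : ℝ)| ≤ N₃ u * N₁ v + N₃ v * N₁ u)
    (ht₁ : ∀ u, N₁ u ≤ N₂ u + N₃ u) (ht₂ : ∀ u, N₂ u ≤ N₃ u + N₁ u)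
    (ht₃ : ∀ u, N₃ u ≤ N₁ u + N₂ u)
    {T : ℝ} (hT : 0 < T)
    (s : Finset ((ℤ × ℤ) × (ℤ × ℤ)))
    (hs : ∀ q ∈ s, |dt q.1 q.2| = 1 ∧
      2 * (max (N₁ q.1) (N₁ q.2) * max (N₂ q.1) (N₂ q.2) * max (N₃ q.1) (N₃ q.2)) ≤ T ^ 3) :
    (s.card : ℝ) ≤ 25200 * (T ^ 2 / δ) := by
  classical
  set n₁ : (ℤ × ℤ) × (ℤ × ℤ) → ℝ := fun q => max (N₁ q.1) (N₁ q.2) with hn₁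
  set n₂ : (ℤ × ℤ) × (ℤ × ℤ) → ℝ := fun q => max (N₂ q.1) (N₂ q.2) with hn₂
  set n₃ : (ℤ × ℤ) × (ℤ × ℤ) → ℝ := fun q => max (N₃ q.1) (N₃ q.2) with hn₃
  have p₁ : ∀ q, 0 ≤ n₁ q := fun q => le_max_of_le_left (h₁.nonneg _)
  have p₂ : ∀ q, 0 ≤ n₂ q := fun q => le_max_of_le_left (h₂.nonneg _)
  have p₃ : ∀ q, 0 ≤ n₃ q := fun q => le_max_of_le_left (h₃.nonneg _)
  have t₁ : ∀ q, n₁ q ≤ n₂ q + n₃ q := fun q => max_le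
    ((ht₁ _).trans (add_le_add (le_max_left _ _) (le_max_left _ _)))
    ((ht₁ _).trans (add_le_add (le_max_right _ _) (le_max_right _ _)))
  have t₂ : ∀ q, n₂ q ≤ n₃ q + n₁ q := fun q => max_le
    ((ht₂ _).trans (add_le_add (le_max_left _ _) (le_max_left _ _)))
    ((ht₂ _).trans (add_le_add (le_max_right _ _) (le_max_right _ _)))
  have t₃ : ∀ q, n₃ q ≤ n₁ q + n₂ q := fun q => max_le
    ((ht₃ _).trans (add_le_add (le_max_left _ _) (le_max_left _ _)))
    ((ht₃ _).trans (add_le_add (le_max_right _ _) (le_max_right _ _)))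
  have gen : ∀ a b c : ℝ, 0 ≤ a → 0 ≤ b → a ≤ c → b ≤ c + a →
      2 * (a * b * c) ≤ T ^ 3 → a * b ^ 2 ≤ T ^ 3 := by
    intro a b c ha hb hac hbc h
    have : a * b * b ≤ a * b * (2 * c) :=
      mul_le_mul_of_nonneg_left (by linarith) (mul_nonneg ha hb)
    linarith [this, show a * b ^ 2 = a * b * b by ring]
  have c1 : ((s.filter fun q => n₁ q ≤ n₂ q ∧ n₁ q ≤ n₃ q).card : ℝ) ≤ 8400 * (T ^ 2 / δ) := by
    apply card_two h₁ h₂ hδ hd₁ hT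
    intro q hq
    rw [Finset.mem_filter] at hq
    obtain ⟨hq, k1, k2⟩ := hq
    exact ⟨(hs q hq).1, k1, gen _ _ (n₃ q) (p₁ q) (p₂ q) k2 (t₂ q) (hs q hq).2⟩
  have c2 : ((s.filter fun q => n₂ q ≤ n₃ q ∧ n₂ q ≤ n₁ q).card : ℝ) ≤ 8400 * (T ^ 2 / δ) := by
    apply card_two h₂ h₃ hδ hd₂ hT
    intro q hq
    rw [Finset.mem_filter] at hq
    obtain ⟨hq, k1, k2⟩ := hq
    refine ⟨(hs q hq).1, k1, gen _ _ (n₁ q) (p₂ q) (p₃ q) k2 (t₃ q) ?_⟩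
    have := (hs q hq).2
    linarith [this, show n₁ q * n₂ q * n₃ q = n₂ q * n₃ q * n₁ q by ring]
  have c3 : ((s.filter fun q => n₃ q ≤ n₁ q ∧ n₃ q ≤ n₂ q).card : ℝ) ≤ 8400 * (T ^ 2 / δ) := by
    apply card_two h₃ h₁ hδ hd₃ hT
    intro q hq
    rw [Finset.mem_filter] at hq
    obtain ⟨hq, k1, k2⟩ := hq
    refine ⟨(hs q hq).1, k1, gen _ _ (n₂ q) (p₃ q) (p₁ q) k2 (t₁ q) ?_⟩
    have := (hs q hq).2
    linarith [this, show n₁ q * n₂ q * n₃ q = n₃ q * n₁ q * n₂ q by ring]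
  have hsub : s ⊆ (s.filter fun q => n₁ q ≤ n₂ q ∧ n₁ q ≤ n₃ q) ∪
      ((s.filter fun q => n₂ q ≤ n₃ q ∧ n₂ q ≤ n₁ q) ∪
       (s.filter fun q => n₃ q ≤ n₁ q ∧ n₃ q ≤ n₂ q)) := by
    intro q hq
    simp only [Finset.mem_union, Finset.mem_filter, hq, true_and]
    rcases le_total (n₁ q) (n₂ q) with a | a <;> rcases le_total (n₂ q) (n₃ q) with b | b <;>
      rcases le_total (n₁ q) (n₃ q) with c | c <;>
      first | tauto | exact Or.inl ⟨a, a.trans b⟩ | exact Or.inr (Or.inr ⟨b.trans a, b⟩)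
  have hc := (Finset.card_le_card hsub).trans ((Finset.card_union_le _ _).trans
    (Nat.add_le_add_left (Finset.card_union_le _ _) _))
  have hcr := (Nat.cast_le (α := ℝ)).2 hc
  push_cast at hcr
  linarith

lemma lin_quad {α β g₀ g₁ g₂ : ℂ} {H : ℝ} (h3 : ‖α * g₂‖ ≤ H) (h2 : ‖α * g₁ + β * g₂‖ ≤ H)
    (h1 : ‖α * g₀ + β * g₁‖ ≤ H) (h0 : ‖β * g₀‖ ≤ H) :
    max ‖α‖ ‖β‖ * ‖g₀‖ ≤ 3 * H ∧ max ‖α‖ ‖β‖ * ‖g₁‖ ≤ 3 * H ∧ max ‖α‖ ‖β‖ * ‖g₂‖ ≤ 3 * H := by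
  have hH : 0 ≤ H := (norm_nonneg _).trans h0
  have a2 : ‖α * g₁‖ ≤ H + ‖β * g₂‖ := by
    have := norm_sub_le (α * g₁ + β * g₂) (β * g₂)
    rw [add_sub_cancel_right] at this; linarith
  have a1 : ‖α * g₀‖ ≤ H + ‖β * g₁‖ := by
    have := norm_sub_le (α * g₀ + β * g₁) (β * g₁)
    rw [add_sub_cancel_right] at this; linarith
  have b2 : ‖β * g₂‖ ≤ H + ‖α * g₁‖ := by
    have := norm_sub_le (α * g₁ + β * g₂) (α * g₁)
    rw [add_sub_cancel_left] at this; linarith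
  have b1 : ‖β * g₁‖ ≤ H + ‖α * g₀‖ := by
    have := norm_sub_le (α * g₀ + β * g₁) (α * g₀)
    rw [add_sub_cancel_left] at this; linarith
  rw [norm_mul] at *
  simp only [norm_mul] at *
  rcases le_total ‖α‖ ‖β‖ with h | h
  · rw [max_eq_right h]
    have e0 := mul_le_mul_of_nonneg_right h (norm_nonneg g₀)
    have e1 := mul_le_mul_of_nonneg_right h (norm_nonneg g₁)
    exact ⟨by linarith, by linarith, by linarith⟩
  · rw [max_eq_left h]
    have e1 := mul_le_mul_of_nonneg_right h (norm_nonneg g₁)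
    have e2 := mul_le_mul_of_nonneg_right h (norm_nonneg g₂)
    exact ⟨by linarith, by linarith, by linarith⟩

lemma lin_lin {α β g₀ g₁ : ℂ} {H : ℝ} (h2 : ‖α * g₁‖ ≤ H)
    (h1 : ‖α * g₀ + β * g₁‖ ≤ H) (h0 : ‖β * g₀‖ ≤ H) :
    max ‖α‖ ‖β‖ * ‖g₀‖ ≤ 2 * H ∧ max ‖α‖ ‖β‖ * ‖g₁‖ ≤ 2 * H := by
  have hH : 0 ≤ H := (norm_nonneg _).trans h0
  have a1 : ‖α * g₀‖ ≤ H + ‖β * g₁‖ := by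
    have := norm_sub_le (α * g₀ + β * g₁) (β * g₁)
    rw [add_sub_cancel_right] at this; linarith
  have b1 : ‖β * g₁‖ ≤ H + ‖α * g₀‖ := by
    have := norm_sub_le (α * g₀ + β * g₁) (α * g₀)
    rw [add_sub_cancel_left] at this; linarith
  simp only [norm_mul] at *
  rcases le_total ‖α‖ ‖β‖ with h | h
  · rw [max_eq_right h]
    have e0 := mul_le_mul_of_nonneg_right h (norm_nonneg g₀)
    exact ⟨by linarith, by linarith⟩
  · rw [max_eq_left h]
    have e1 := mul_le_mul_of_nonneg_right h (norm_nonneg g₁)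
    exact ⟨by linarith, by linarith⟩

/-- Gelfond's inequality for a product of three linear forms -/
lemma gelfond {p α₁ β₁ α₂ β₂ α₃ β₃ : ℂ} {H : ℝ}
    (h3 : ‖p * α₁ * α₂ * α₃‖ ≤ H)
    (h2 : ‖p * (α₁ * α₂ * β₃ + α₁ * β₂ * α₃ + β₁ * α₂ * α₃)‖ ≤ H)
    (h1 : ‖p * (α₁ * β₂ * β₃ + β₁ * α₂ * β₃ + β₁ * β₂ * α₃)‖ ≤ H)
    (h0 : ‖p * β₁ * β₂ * β₃‖ ≤ H) :
    ‖p‖ * (max ‖α₁‖ ‖β₁‖ * max ‖α₂‖ ‖β₂‖ * max ‖α₃‖ ‖β₃‖) ≤ 6 * H := by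
  obtain ⟨k0, k1, k2⟩ := lin_quad (α := α₁) (β := β₁) (g₀ := p * β₂ * β₃)
    (g₁ := p * (α₂ * β₃ + β₂ * α₃)) (g₂ := p * α₂ * α₃) (H := H)
    (by convert h3 using 2; ring) (by convert h2 using 2; ring)
    (by convert h1 using 2; ring) (by convert h0 using 2; ring)
  set M := max ‖α₁‖ ‖β₁‖ with hM
  have hM0 : 0 ≤ M := le_max_of_le_left (norm_nonneg _)
  have nM : ∀ z : ℂ, ‖(M : ℂ) * z‖ = M * ‖z‖ := by
    intro z; rw [norm_mul, Complex.norm_real, Real.norm_of_nonneg hM0]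
  obtain ⟨l0, l1⟩ := lin_lin (α := α₂) (β := β₂) (g₀ := M * (p * β₃))
    (g₁ := M * (p * α₃)) (H := 3 * H)
    (by
      rw [show α₂ * (M * (p * α₃)) = M * (p * α₂ * α₃) by ring, nM]; exact k2)
    (by
      rw [show α₂ * (M * (p * β₃)) + β₂ * (M * (p * α₃)) = M * (p * (α₂ * β₃ + β₂ * α₃)) by ring,
        nM]; exact k1)
    (by
      rw [show β₂ * (M * (p * β₃)) = M * (p * β₂ * β₃) by ring, nM]; exact k0)
  rw [nM, norm_mul] at l0 l1
  rcases le_total ‖α₃‖ ‖β₃‖ with h | h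
  · rw [max_eq_right h]; linarith
  · rw [max_eq_left h]; linarith

/-- the weighted absolute value of a linear form -/
noncomputable def Nf (l : ℝ) (θ : ℂ) (u : ℤ × ℤ) : ℝ := l * ‖(u.1 : ℂ) - θ * (u.2 : ℂ)‖

lemma Nf_sn {l : ℝ} (hl : 0 ≤ l) (θ : ℂ) : SN (Nf l θ) := by
  refine ⟨fun u => by unfold Nf; positivity, fun u v => ?_, fun k u => ?_⟩
  · unfold Nf
    rw [← mul_add]
    apply mul_le_mul_of_nonneg_left _ hl
    refine le_trans (le_of_eq ?_) (norm_sub_le _ _)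
    congr 1
    simp only [Prod.fst_sub, Prod.snd_sub]
    push_cast; ring
  · unfold Nf
    have : (((k • u).1 : ℤ) : ℂ) - θ * ((k • u).2 : ℤ) = ((k : ℝ) : ℂ) * ((u.1 : ℂ) - θ * (u.2 : ℂ)) := by
      simp only [Prod.smul_fst, Prod.smul_snd, smul_eq_mul]
      push_cast; ring
    rw [this, norm_mul, Complex.norm_real, Real.norm_eq_abs]; ring

lemma Nf_det {l₁ l₂ : ℝ} (hl₁ : 0 ≤ l₁) (hl₂ : 0 ≤ l₂) (θ₁ θ₂ : ℂ) (u v : ℤ × ℤ) :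
    (l₁ * l₂ * ‖θ₁ - θ₂‖) * |(dt u v : ℝ)| ≤
      Nf l₁ θ₁ u * Nf l₂ θ₂ v + Nf l₁ θ₁ v * Nf l₂ θ₂ u := by
  have e : (θ₁ - θ₂) * ((dt u v : ℝ) : ℂ) =
      ((u.1 : ℂ) - θ₁ * u.2) * ((v.1 : ℂ) - θ₂ * v.2) -
      ((v.1 : ℂ) - θ₁ * v.2) * ((u.1 : ℂ) - θ₂ * u.2) := by
    unfold dt; push_cast; ring
  have h := norm_sub_le (((u.1 : ℂ) - θ₁ * u.2) * ((v.1 : ℂ) - θ₂ * v.2))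
      (((v.1 : ℂ) - θ₁ * v.2) * ((u.1 : ℂ) - θ₂ * u.2))
  rw [← e] at h
  simp only [norm_mul, Complex.norm_real, Real.norm_eq_abs] at h
  have := mul_le_mul_of_nonneg_left h (mul_nonneg hl₁ hl₂)
  unfold Nf
  linarith

lemma Nf_tri (t : ℝ) (ht : 0 ≤ t) (x y z : ℂ) (u : ℤ × ℤ) :
    Nf (t * ‖y - z‖) x u ≤ Nf (t * ‖z - x‖) y u + Nf (t * ‖x - y‖) z u := by
  have e : (y - z) * ((u.1 : ℂ) - x * u.2) =
      - ((z - x) * ((u.1 : ℂ) - y * u.2)) - (x - y) * ((u.1 : ℂ) - z * u.2) := by ring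
  have h := norm_sub_le (- ((z - x) * ((u.1 : ℂ) - y * u.2))) ((x - y) * ((u.1 : ℂ) - z * u.2))
  rw [← e, norm_neg] at h
  simp only [norm_mul] at h
  have := mul_le_mul_of_nonneg_left h ht
  unfold Nf
  linarith

lemma coeffs {p q : Fin 4 → ℤ} {a b c d : ℤ}
    (h : (∑ i : Fin 4, C (q i) * X ^ (i : ℕ)) =
      ∑ i : Fin 4, C (p i) * (C a * X + C b) ^ (i : ℕ) * (C c * X + C d) ^ (3 - (i : ℕ))) :
    q 3 = p 0 * c ^ 3 + p 1 * a * c ^ 2 + p 2 * a ^ 2 * c + p 3 * a ^ 3 ∧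
    q 2 = p 0 * (3 * c ^ 2 * d) + p 1 * (2 * a * c * d + b * c ^ 2) +
      p 2 * (a ^ 2 * d + 2 * a * b * c) + p 3 * (3 * a ^ 2 * b) ∧
    q 1 = p 0 * (3 * c * d ^ 2) + p 1 * (a * d ^ 2 + 2 * b * c * d) +
      p 2 * (2 * a * b * d + b ^ 2 * c) + p 3 * (3 * a * b ^ 2) ∧
    q 0 = p 0 * d ^ 3 + p 1 * b * d ^ 2 + p 2 * b ^ 2 * d + p 3 * b ^ 3 := by
  have hL : (∑ i : Fin 4, C (q i) * X ^ (i : ℕ)) = (Cubic.mk (q 3) (q 2) (q 1) (q 0)).toPoly := by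
    simp [Fin.sum_univ_four, Cubic.toPoly]; ring
  have hR : (∑ i : Fin 4, C (p i) * (C a * X + C b) ^ (i : ℕ) * (C c * X + C d) ^ (3 - (i : ℕ))) =
      (Cubic.mk (p 0 * c ^ 3 + p 1 * a * c ^ 2 + p 2 * a ^ 2 * c + p 3 * a ^ 3)
        (p 0 * (3 * c ^ 2 * d) + p 1 * (2 * a * c * d + b * c ^ 2) +
          p 2 * (a ^ 2 * d + 2 * a * b * c) + p 3 * (3 * a ^ 2 * b))
        (p 0 * (3 * c * d ^ 2) + p 1 * (a * d ^ 2 + 2 * b * c * d) +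
          p 2 * (2 * a * b * d + b ^ 2 * c) + p 3 * (3 * a * b ^ 2))
        (p 0 * d ^ 3 + p 1 * b * d ^ 2 + p 2 * b ^ 2 * d + p 3 * b ^ 3)).toPoly := by
    have h2 : (C (2 : ℤ) : ℤ[X]) = 2 := rfl
    have h3 : (C (3 : ℤ) : ℤ[X]) = 3 := rfl
    simp only [Fin.sum_univ_four, Cubic.toPoly, C_add, C_mul, C_pow, h2, h3]
    norm_num [Fin.val_zero, Fin.val_one, Fin.val_two]
    ring
  rw [hL, hR] at h
  have := (Cubic.toPoly_injective _ _).1 h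
  simpa [Cubic.ext_iff] using this

lemma exists_roots (p : Fin 4 → ℤ) (h : p 3 ≠ 0) : ∃ x y z : ℂ,
    (p 2 : ℂ) = p 3 * -(x + y + z) ∧ (p 1 : ℂ) = p 3 * (x * y + x * z + y * z) ∧
    (p 0 : ℂ) = p 3 * -(x * y * z) := by
  have ha : (Cubic.mk (p 3) (p 2) (p 1) (p 0) : Cubic ℤ).a ≠ 0 := h
  set P : Cubic ℂ := (Cubic.mk (p 3 : ℂ) (p 2 : ℂ) (p 1 : ℂ) (p 0 : ℂ)) with hP
  have ha : P.a ≠ 0 := by simpa [hP] using h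
  obtain ⟨x, y, z, h3⟩ := (Cubic.splits_iff_roots_eq_three (φ := RingHom.id ℂ) ha).1
    (IsAlgClosed.splits _)
  refine ⟨x, y, z, ?_, ?_, ?_⟩
  · simpa [hP] using Cubic.b_eq_three_roots ha h3
  · simpa [hP] using Cubic.c_eq_three_roots ha h3
  · simpa [hP] using Cubic.d_eq_three_roots ha h3

end CubicCount

open CubicCount

/-- For every `ε > 0` there is `c = c(ε) > 0` such that for every cubic integer
polynomial `P` of nonzero discriminant and every `H ≥ 1`, the number of integer
polynomials of degree at most 3 equivalent to `P` of naive height at most `H` is at most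
`c·H^{2/3+ε}·|D(P)|^{−1/6}`. -/
theorem stmt12 (ε : ℝ) (hε : 0 < ε) :
    ∃ c : ℝ, 0 < c ∧
      ∀ p : Fin 4 → ℤ, p 3 ≠ 0 → cubicDisc (p 0) (p 1) (p 2) (p 3) ≠ 0 →
      ∀ H : ℝ, 1 ≤ H →
        (({q : Fin 4 → ℤ | cubicEquiv p q ∧ ∀ i, |(q i : ℝ)| ≤ H}).ncard : ℝ) ≤
          c * H ^ ((2 : ℝ) / 3 + ε) *
            |(cubicDisc (p 0) (p 1) (p 2) (p 3) : ℝ)| ^ (-(1 / 6 : ℝ)) := by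
  refine ⟨25200 * 12, by norm_num, ?_⟩
  intro p hp3 hD H hH
  classical
  set S := {q : Fin 4 → ℤ | cubicEquiv p q ∧ ∀ i, |(q i : ℝ)| ≤ H} with hS
  have hrhs : 0 ≤ 25200 * 12 * H ^ ((2 : ℝ) / 3 + ε) *
            |(cubicDisc (p 0) (p 1) (p 2) (p 3) : ℝ)| ^ (-(1 / 6 : ℝ)) := by positivity
  rcases S.finite_or_infinite with hfin | hinf
  swap
  · rw [hinf.ncard]; simpa using hrhs
  obtain ⟨x, y, z, e2, e1, e0⟩ := exists_roots p hp3
  have hDC : ((cubicDisc (p 0) (p 1) (p 2) (p 3) : ℤ) : ℂ) =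
      (p 3 : ℂ) ^ 4 * ((x - y) * (y - z) * (z - x)) ^ 2 := by
    unfold cubicDisc
    push_cast
    rw [e2, e1, e0]
    ring
  set Δ : ℝ := ‖x - y‖ * ‖y - z‖ * ‖z - x‖ with hΔ
  have hDR : |(cubicDisc (p 0) (p 1) (p 2) (p 3) : ℝ)| = |(p 3 : ℝ)| ^ 4 * Δ ^ 2 := by
    have := congrArg norm hDC
    simpa [norm_mul, norm_pow, Complex.norm_intCast, hΔ] using this
  have hp3' : 0 < |(p 3 : ℝ)| := by
    rw [abs_pos]; exact_mod_cast hp3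
  have hΔ0 : 0 < Δ := by
    have h0 : 0 ≤ Δ := by positivity
    rcases h0.lt_or_eq with h | h
    · exact h
    · exfalso
      rw [← h] at hDR
      apply hD
      have : |(cubicDisc (p 0) (p 1) (p 2) (p 3) : ℝ)| = 0 := by rw [hDR]; ring
      exact_mod_cast abs_eq_zero.1 this
  set t : ℝ := (|(p 3 : ℝ)| / Δ) ^ ((1 : ℝ) / 3) with ht
  have ht0 : 0 < t := by positivity
  have ht3 : t ^ 3 * Δ = |(p 3 : ℝ)| := by
    rw [ht, ← Real.rpow_natCast, ← Real.rpow_mul (by positivity)]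
    norm_num
    field_simp
  set δ : ℝ := t ^ 2 * Δ with hδ
  have hδ0 : 0 < δ := by positivity
  have hδD : |(cubicDisc (p 0) (p 1) (p 2) (p 3) : ℝ)| ^ (-(1 / 6 : ℝ)) = 1 / δ := by
    have h6 : |(cubicDisc (p 0) (p 1) (p 2) (p 3) : ℝ)| = δ ^ 6 := by
      rw [hDR, ← ht3, hδ]; ring
    rw [h6, ← Real.rpow_natCast, ← Real.rpow_mul hδ0.le]
    norm_num
    exact Real.rpow_neg_one δ
  set T : ℝ := (12 * H) ^ ((1 : ℝ) / 3) with hT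
  have hT0 : 0 < T := by positivity
  have hT3 : T ^ 3 = 12 * H := by
    rw [hT, ← Real.rpow_natCast, ← Real.rpow_mul (by positivity)]
    norm_num
  have hT2 : T ^ 2 ≤ 12 * H ^ ((2 : ℝ) / 3 + ε) := by
    have a1 : T ^ 2 = (12 * H) ^ ((2 : ℝ) / 3) := by
      rw [hT, ← Real.rpow_natCast, ← Real.rpow_mul (by positivity)]
      norm_num
    rw [a1, Real.mul_rpow (by norm_num) (by positivity)]
    have a2 : (12 : ℝ) ^ ((2 : ℝ) / 3) ≤ 12 := by
      calc (12 : ℝ) ^ ((2 : ℝ) / 3) ≤ (12 : ℝ) ^ (1 : ℝ) :=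
            Real.rpow_le_rpow_of_exponent_le (by norm_num) (by norm_num)
        _ = 12 := Real.rpow_one _
    have a3 : H ^ ((2 : ℝ) / 3) ≤ H ^ ((2 : ℝ) / 3 + ε) :=
      Real.rpow_le_rpow_of_exponent_le hH (by linarith)
    exact mul_le_mul a2 a3 (by positivity) (by norm_num)
  -- choose a matrix for each form
  have hex : ∀ q : Fin 4 → ℤ, ∃ g : (ℤ × ℤ) × (ℤ × ℤ), q ∈ S → |dt g.1 g.2| = 1 ∧
      (∑ i : Fin 4, C (q i) * X ^ (i : ℕ)) =
      ∑ i : Fin 4, C (p i) * (C g.1.1 * X + C g.2.1) ^ (i : ℕ) *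
        (C g.1.2 * X + C g.2.2) ^ (3 - (i : ℕ)) := by
    intro q
    by_cases hq : q ∈ S
    · obtain ⟨a, b, c, d, hdet, heq⟩ := hq.1
      refine ⟨((a, c), (b, d)), fun _ => ⟨?_, heq⟩⟩
      have : dt (a, c) (b, d) = a * d - b * c := by unfold dt; ring
      rw [this]
      rcases hdet with h | h <;> rw [h] <;> norm_num
    · exact ⟨0, fun h => absurd h hq⟩
  choose g hg using hex
  set s := hfin.toFinset.image g with hs
  have hcard : S.ncard = s.card := by
    rw [Set.ncard_eq_toFinset_card S hfin, hs, Finset.card_image_of_injOn]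
    intro q hq q' hq' hqq
    have hq1 : q ∈ S := by simpa using hq
    have hq2 : q' ∈ S := by simpa using hq'
    have k1 := coeffs (hg q hq1).2
    have k2 := coeffs (hg q' hq2).2
    rw [← hqq] at k2
    funext i
    fin_cases i
    · exact k1.2.2.2.trans k2.2.2.2.symm
    · exact k1.2.2.1.trans k2.2.2.1.symm
    · exact k1.2.1.trans k2.2.1.symm
    · exact k1.1.trans k2.1.symm
  have hl1 : 0 ≤ t * ‖y - z‖ := by positivity
  have hl2 : 0 ≤ t * ‖z - x‖ := by positivity
  have hl3 : 0 ≤ t * ‖x - y‖ := by positivity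
  have main := card_three (N₁ := Nf (t * ‖y - z‖) x) (N₂ := Nf (t * ‖z - x‖) y)
    (N₃ := Nf (t * ‖x - y‖) z) (Nf_sn hl1 x) (Nf_sn hl2 y) (Nf_sn hl3 z) hδ0
    (fun u v => by
      have := Nf_det hl1 hl2 x y u v
      rwa [show t * ‖y - z‖ * (t * ‖z - x‖) * ‖x - y‖ = δ by rw [hδ, hΔ]; ring] at this)
    (fun u v => by
      have := Nf_det hl2 hl3 y z u v
      rwa [show t * ‖z - x‖ * (t * ‖x - y‖) * ‖y - z‖ = δ by rw [hδ, hΔ]; ring] at this)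
    (fun u v => by
      have := Nf_det hl3 hl1 z x u v
      rwa [show t * ‖x - y‖ * (t * ‖y - z‖) * ‖z - x‖ = δ by rw [hδ, hΔ]; ring] at this)
    (fun u => Nf_tri t ht0.le x y z u) (fun u => Nf_tri t ht0.le y z x u)
    (fun u => Nf_tri t ht0.le z x y u) hT0 s (by
      intro m hm
      rw [hs, Finset.mem_image] at hm
      obtain ⟨q, hq, rfl⟩ := hm
      have hqS : q ∈ S := by simpa using hq
      refine ⟨(hg q hqS).1, ?_⟩
      obtain ⟨k3, k2, k1, k0⟩ := coeffs (hg q hqS).2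
      generalize g q = m at k3 k2 k1 k0
      obtain ⟨⟨a, c⟩, ⟨b, d⟩⟩ := m
      simp only at k3 k2 k1 k0
      have hn : ∀ i, ‖(q i : ℂ)‖ ≤ H := by
        intro i; rw [Complex.norm_intCast]; exact hqS.2 i
      have G := gelfond (p := (p 3 : ℂ)) (α₁ := (a : ℂ) - x * c) (β₁ := (b : ℂ) - x * d)
        (α₂ := (a : ℂ) - y * c) (β₂ := (b : ℂ) - y * d)
        (α₃ := (a : ℂ) - z * c) (β₃ := (b : ℂ) - z * d) (H := H)
        (by
          convert hn 3 using 2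
          rw [k3]; push_cast; rw [e2, e1, e0]; ring)
        (by
          convert hn 2 using 2
          rw [k2]; push_cast; rw [e2, e1, e0]; ring)
        (by
          convert hn 1 using 2
          rw [k1]; push_cast; rw [e2, e1, e0]; ring)
        (by
          convert hn 0 using 2
          rw [k0]; push_cast; rw [e2, e1, e0]; ring)
      unfold Nf
      simp only
      rw [← mul_max_of_nonneg _ _ hl1, ← mul_max_of_nonneg _ _ hl2, ← mul_max_of_nonneg _ _ hl3, hT3]
      rw [Complex.norm_intCast, ← ht3, hΔ] at G
      linarith)
  rw [hcard, hδD]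
  calc (s.card : ℝ) ≤ 25200 * (T ^ 2 / δ) := main
    _ ≤ 25200 * ((12 * H ^ ((2 : ℝ) / 3 + ε)) / δ) := by gcongr
    _ = _ := by ring
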